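/- For every S > 0, all real numbers d > k ≥ 1, and every real N > 0, one has p̂(S, N, 1, k) < p̂(S, N, 1, d); equivalently, Q( √S / √( (k/(2S) + 1)/N + k/(4S·N²) + 1 ) ) < Q( √S / √( (d/(2S) + 1)/N + d/(4S·N²) + 1 ) ). -/

import Mathlib

open MeasureTheory

/-- The Gaussian tail function `Q(x) = (1/√(2π)) · ∫_x^∞ exp(−t²/2) dt`. -/
noncomputable def gaussQ (x : ℝ) : ℝ :=
  (Real.sqrt (2 * Real.pi))⁻¹ * ∫ t in Set.Ioi x, Real.exp (-t ^ 2 / 2)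

/-- The approximate probability of error `p̂(S, N, γ, q)` from the paper. -/
noncomputable def phat (S N γ q : ℝ) : ℝ :=
  (1 / 2) * gaussQ ((Real.sqrt S + (1 / (4 * N)) * ((1 - γ) / γ) * (q / Real.sqrt S)) /
      Real.sqrt ((1 / (4 * N)) * ((1 + γ) / γ) * (q / S)
        + (1 / (8 * N ^ 2)) * ((1 + γ ^ 2) / γ ^ 2) * (q / S) + 1 / (γ * N) + 1))
  + (1 / 2) * gaussQ ((Real.sqrt S - (1 / (4 * N)) * ((1 - γ) / γ) * (q / Real.sqrt S)) /
      Real.sqrt ((1 / (4 * N)) * ((1 + γ) / γ) * (q / S)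
        + (1 / (8 * N ^ 2)) * ((1 + γ ^ 2) / γ ^ 2) * (q / S) + 1 / N + 1))

theorem integrable_exp_neg_sq_div_two :
    Integrable (fun t : ℝ => Real.exp (-t ^ 2 / 2)) := by
  convert integrable_exp_neg_mul_sq (b := 1 / 2) (by norm_num) using 3
  ring

theorem gaussQ_strictAnti : StrictAnti gaussQ := by
  intro x y hxy
  have hint := integrable_exp_neg_sq_div_two
  have hsplit : (∫ t in Set.Ioi x, Real.exp (-t ^ 2 / 2)) =
      (∫ t in x..y, Real.exp (-t ^ 2 / 2)) + ∫ t in Set.Ioi y, Real.exp (-t ^ 2 / 2) :=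
    (intervalIntegral.integral_interval_add_Ioi hint.integrableOn hint.integrableOn).symm
  have hpos : 0 < ∫ t in x..y, Real.exp (-t ^ 2 / 2) :=
    intervalIntegral.intervalIntegral_pos_of_pos hint.intervalIntegrable
      (fun t => Real.exp_pos _) hxy
  unfold gaussQ
  refine mul_lt_mul_of_pos_left ?_ (by positivity)
  linarith

theorem phat_one {S N : ℝ} (hS : 0 < S) (hN : 0 < N) (q : ℝ) :
    phat S N 1 q =
      gaussQ (√S / √((q / (2 * S) + 1) / N + q / (4 * S * N ^ 2) + 1)) := by
  have hden : 1 / (4 * N) * ((1 + 1) / 1) * (q / S)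
      + 1 / (8 * N ^ 2) * ((1 + 1 ^ 2) / 1 ^ 2) * (q / S) + 1 / N + 1 =
      (q / (2 * S) + 1) / N + q / (4 * S * N ^ 2) + 1 := by
    field_simp
    ring
  simp only [phat, one_mul (N), hden, sub_self, zero_div, mul_zero, zero_mul, add_zero, sub_zero]
  ring

theorem gain_balanced (S : ℝ) (hS : 0 < S) (d k : ℝ) (hk : 1 ≤ k) (hkd : k < d)
    (N : ℝ) (hN : 0 < N) :
    phat S N 1 k < phat S N 1 d ∧
    gaussQ (Real.sqrt S / Real.sqrt ((k / (2 * S) + 1) / N + k / (4 * S * N ^ 2) + 1)) <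
      gaussQ (Real.sqrt S / Real.sqrt ((d / (2 * S) + 1) / N + d / (4 * S * N ^ 2) + 1)) := by
  have hlt : gaussQ (√S / √((k / (2 * S) + 1) / N + k / (4 * S * N ^ 2) + 1)) <
      gaussQ (√S / √((d / (2 * S) + 1) / N + d / (4 * S * N ^ 2) + 1)) := by
    have hk0 : 0 < k := by linarith
    apply gaussQ_strictAnti
    gcongr
  exact ⟨by rwa [phat_one hS hN, phat_one hS hN], hlt⟩
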